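/- Let δ(X) = (ad_X ⊗ 1 + 1 ⊗ ad_X)(Σ_a P_a ⊗ J_a) on iso(3), and identify iso(3)* with iso(3) via the nondegenerate form B (B(J_a,P_b) = δ_{ab}, B(J_a,J_b) = B(P_a,P_b) = 0). Then the dual bracket [·,·]* on iso(3), defined by B([ξ,η]*, X) = (B ⊗ B)(ξ ⊗ η, δ(X)) for all X, is given by [J_a,J_b]* = ε_{abc}J_c and [J_a,P_b]* = [P_a,P_b]* = 0; in particular [·,·]* is a Lie bracket and the resulting Lie algebra iso(3)* is isomorphic to the Lie algebra direct sum of so(3) (the span of the J_a with cross-product bracket) and the 3-dimensional abelian Lie algebra ℝ³. -/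

import Mathlib

open scoped BigOperators

/-- ℝ³, realised as functions `Fin 3 → ℝ`. -/
abbrev V3 : Type := Fin 3 → ℝ

/-- The totally antisymmetric tensor in three dimensions, normalised so that `ε 0 1 2 = 1`. -/
noncomputable def eps (a b c : Fin 3) : ℝ :=
  (((b : ℕ) : ℝ) - ((a : ℕ) : ℝ)) * (((c : ℕ) : ℝ) - ((b : ℕ) : ℝ))
    * (((c : ℕ) : ℝ) - ((a : ℕ) : ℝ)) / 2

/-- The basis elements `J_a = (e_a, 0)` of `iso(3) = ℝ³ ⊕ ℝ³`. -/
def Jb (a : Fin 3) : V3 × V3 := (Pi.single a 1, 0)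

/-- The basis elements `P_a = (0, e_a)` of `iso(3) = ℝ³ ⊕ ℝ³`. -/
def Pb (a : Fin 3) : V3 × V3 := (0, Pi.single a 1)

/-- The `iso(3)` bracket: `[J_a,J_b] = ε_{abc}J_c`, `[J_a,P_b] = ε_{abc}P_c`,
`[P_a,P_b] = 0`; equivalently `[(j₁,p₁),(j₂,p₂)] = (j₁×j₂, j₁×p₂ − j₂×p₁)`. -/
def isoBracket (x y : V3 × V3) : V3 × V3 :=
  (crossProduct x.1 y.1, crossProduct x.1 y.2 - crossProduct y.1 x.2)

/-- The bilinear form on `iso(3)` with `B(J_a,P_b) = δ_{ab}`,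
`B(J_a,J_b) = B(P_a,P_b) = 0`, used to identify `iso(3)*` with `iso(3)`. -/
def Bform (x y : V3 × V3) : ℝ := (∑ i, x.1 i * y.2 i) + (∑ i, x.2 i * y.1 i)

/-- The dual bracket on `iso(3)* ≃ iso(3)`: `[J_a,J_b]* = ε_{abc}J_c`,
`[J_a,P_b]* = [P_a,P_b]* = 0`; i.e. `[(j₁,p₁),(j₂,p₂)]* = (j₁×j₂, 0)`, which is
precisely the bracket of the Lie algebra direct sum `so(3) ⊕ ℝ³` (with ℝ³ abelian). -/
def dualBracket (x y : V3 × V3) : V3 × V3 := (crossProduct x.1 y.1, 0)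

/-- Identifying `iso(3)*` with `iso(3)` via `B`, the bracket dual to the co-commutator
`δ(X) = (ad_X ⊗ 1 + 1 ⊗ ad_X)(Σ_a P_a ⊗ J_a)`, characterised by
`B([ξ,η]*, X) = (B ⊗ B)(ξ ⊗ η, δ(X))`, is given by `[J_a,J_b]* = ε_{abc}J_c`,
`[J_a,P_b]* = [P_a,P_b]* = 0`; it is a Lie bracket, and the resulting Lie algebra
`iso(3)*` is the direct sum of `so(3)` (span of the `J_a`, with cross-product bracket)
and the abelian Lie algebra ℝ³. -/
theorem dual_bracket_of_cocommutator :
    (∀ ξ η X : V3 × V3,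
      Bform (dualBracket ξ η) X
        = ∑ b : Fin 3, (Bform ξ (isoBracket X (Pb b)) * Bform η (Jb b)
            + Bform ξ (Pb b) * Bform η (isoBracket X (Jb b)))) ∧
    (∀ a b : Fin 3, dualBracket (Jb a) (Jb b) = ∑ c, eps a b c • Jb c) ∧
    (∀ a b : Fin 3, dualBracket (Jb a) (Pb b) = 0) ∧
    (∀ a b : Fin 3, dualBracket (Pb a) (Pb b) = 0) ∧
    (∀ x y : V3 × V3, dualBracket x y = - dualBracket y x) ∧
    (∀ x y z : V3 × V3,
      dualBracket x (dualBracket y z) + dualBracket y (dualBracket z x)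
        + dualBracket z (dualBracket x y) = 0) := by
  refine ⟨fun ξ η X => ?_, fun a b => ?_, fun a b => ?_, fun a b => ?_, fun x y => ?_,
    fun x y z => ?_⟩
  · simp [Bform, dualBracket, isoBracket, Jb, Pb, crossProduct, Fin.sum_univ_three]
    ring
  · ext i
    · fin_cases a <;> fin_cases b <;> fin_cases i <;>
        norm_num [Pi.single_apply, Fin.ext_iff, dualBracket, Jb, eps, crossProduct, Fin.sum_univ_three]
    · simp [dualBracket, Jb, Fin.sum_univ_three]
  · simp [dualBracket, Jb, Pb]
  · simp [dualBracket, Pb]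
  · simp [dualBracket]
  · simp [dualBracket, jacobi_cross]
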